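/- Let θ > 0, N₀ > 0, B > 0 and A > 0 be real numbers. Then the function f(p, φ) = −(φ/θ)·ln( (N₀·B·φ/p)·e^{N₀·B·φ/p}·E_A(N₀·B·φ/p) ) is concave on the convex set {(p, φ) ∈ ℝ² : p > 0 and 0 < φ ≤ 1}, where E_A(x) = ∫_1^∞ e^{−x t}·t^{−A} dt. -/

import Mathlib

open MeasureTheory

/-- The generalized exponential integral `E_A(x) = ∫_1^∞ e^{−x·t}·t^{−A} dt`. -/
noncomputable def expInt (A x : ℝ) : ℝ :=
  ∫ t in Set.Ioi (1 : ℝ), Real.exp (-x * t) * t ^ (-A)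

/-- The mean of `(1 + γ U)^{-A}` for a standard exponential variable `U`. -/
noncomputable def expMean (A γ : ℝ) : ℝ :=
  ∫ u in Set.Ioi (0 : ℝ), Real.exp (-u) * (1 + γ * u) ^ (-A)

theorem mul_exp_mul_expInt (A : ℝ) {x : ℝ} (hx : 0 < x) :
    x * Real.exp x * expInt A x = expMean A x⁻¹ := by
  have hscale := integral_comp_mul_left_Ioi
    (fun u => Real.exp (-u) * (1 + x⁻¹ * u) ^ (-A)) 0 hx
  have hshift : ∫ t in Set.Ioi (1 : ℝ), Real.exp (-(x * (t - 1))) * t ^ (-A) =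
      ∫ s in Set.Ioi (0 : ℝ), Real.exp (-(x * s)) * (1 + s) ^ (-A) := by
    have hmp := (measurePreserving_add_left volume (1 : ℝ)).setIntegral_preimage_emb
      (measurableEmbedding_addLeft 1)
      (fun t => Real.exp (-(x * (t - 1))) * t ^ (-A)) (Set.Ioi 1)
    simpa using hmp.symm
  have hcancel : ∀ s, 1 + x⁻¹ * (x * s) = 1 + s := fun s => by field_simp
  simp only [hcancel, mul_zero, smul_eq_mul] at hscale
  rw [expMean, ← mul_inv_cancel_left₀ hx.ne' (∫ u in Set.Ioi (0 : ℝ), _), ← hscale, ← hshift,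
    expInt, mul_assoc, ← integral_const_mul]
  congr 2
  ext t
  rw [← mul_assoc, ← Real.exp_add]
  ring_nf

theorem integrableOn_expMean {A γ : ℝ} (hA : 0 ≤ A) (hγ : 0 ≤ γ) :
    IntegrableOn (fun u : ℝ => Real.exp (-u) * (1 + γ * u) ^ (-A)) (Set.Ioi 0) := by
  refine Integrable.mono' (integrableOn_exp_neg_Ioi 0) (by measurability) ?_
  filter_upwards [ae_restrict_mem measurableSet_Ioi] with u hu
  have hbase : 1 ≤ 1 + γ * u := le_add_of_nonneg_right (mul_nonneg hγ (le_of_lt hu))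
  rw [Real.norm_of_nonneg (by positivity)]
  exact mul_le_of_le_one_right (Real.exp_pos _).le
    (Real.rpow_le_one_of_one_le_of_nonpos hbase (by linarith))

theorem expMean_pos {A γ : ℝ} (hA : 0 ≤ A) (hγ : 0 ≤ γ) : 0 < expMean A γ := by
  have hpos : ∀ u ∈ Set.Ioi (0 : ℝ), 0 < Real.exp (-u) * (1 + γ * u) ^ (-A) := fun u hu => by
    have hu' : 0 < u := hu
    positivity
  rw [expMean, setIntegral_pos_iff_support_of_nonneg_ae
    ((ae_restrict_mem measurableSet_Ioi).mono fun u hu => (hpos u hu).le)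
    (integrableOn_expMean hA hγ),
    Set.inter_eq_right.mpr fun u hu => Function.mem_support.mpr (hpos u hu).ne']
  simp

/-- Log-convexity of `expMean A`, a Hölder-type inequality. -/
theorem convexOn_log_expMean {A : ℝ} (hA : 0 ≤ A) :
    ConvexOn ℝ (Set.Ici 0) fun γ => Real.log (expMean A γ) := by
  refine ⟨convex_Ici 0, fun γ hγ δ hδ a b ha hb hab => ?_⟩
  rw [Set.mem_Ici] at hγ hδ
  have hγpos := expMean_pos hA hγ
  have hδpos := expMean_pos hA hδ
  have hmix : 0 ≤ a * γ + b * δ := by positivity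
  set m := expMean A γ ^ a * expMean A δ ^ b with hm
  have hmpos : 0 < m := by positivity
  have hpoint : ∀ u ∈ Set.Ioi (0 : ℝ), Real.exp (-u) * (1 + (a * γ + b * δ) * u) ^ (-A) ≤
      m * (a / expMean A γ) * (Real.exp (-u) * (1 + γ * u) ^ (-A)) +
        m * (b / expMean A δ) * (Real.exp (-u) * (1 + δ * u) ^ (-A)) := by
    intro u hu
    have hu' : 0 < u := hu
    have hγu : 0 < 1 + γ * u := by positivity
    have hδu : 0 < 1 + δ * u := by positivity
    have hbase := Real.geom_mean_le_arith_mean2_weighted ha hb hγu.le hδu.le hab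
    have hmixed : a * (1 + γ * u) + b * (1 + δ * u) = 1 + (a * γ + b * δ) * u := by
      linear_combination hab
    rw [hmixed] at hbase
    have hpow := Real.rpow_le_rpow_of_nonpos (by positivity) hbase (neg_nonpos.mpr hA)
    rw [Real.mul_rpow (by positivity) (by positivity), ← Real.rpow_mul hγu.le,
      ← Real.rpow_mul hδu.le, mul_comm a (-A), mul_comm b (-A), Real.rpow_mul hγu.le,
      Real.rpow_mul hδu.le] at hpow
    have hyoung := Real.geom_mean_le_arith_mean2_weighted ha hb
      (p₁ := (1 + γ * u) ^ (-A) / expMean A γ) (p₂ := (1 + δ * u) ^ (-A) / expMean A δ)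
      (by positivity) (by positivity) hab
    rw [Real.div_rpow (by positivity) hγpos.le, Real.div_rpow (by positivity) hδpos.le,
      div_mul_div_comm, ← hm, div_le_iff₀ hmpos] at hyoung
    refine (mul_le_mul_of_nonneg_left (hpow.trans hyoung) (Real.exp_pos _).le).trans_eq ?_
    ring
  have hintegral : expMean A (a * γ + b * δ) ≤ m := by
    have hγint := (integrableOn_expMean hA hγ).const_mul (m * (a / expMean A γ))
    have hδint := (integrableOn_expMean hA hδ).const_mul (m * (b / expMean A δ))
    refine (setIntegral_mono_on (integrableOn_expMean hA hmix) (hγint.add hδint)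
      measurableSet_Ioi hpoint).trans_eq ?_
    rw [integral_add' hγint hδint, integral_const_mul, integral_const_mul,
      ← expMean, ← expMean]
    field_simp
    exact hab
  simp only [smul_eq_mul]
  refine (Real.log_le_log (expMean_pos hA hmix) hintegral).trans_eq ?_
  rw [hm, Real.log_mul (by positivity) (by positivity), Real.log_rpow hγpos, Real.log_rpow hδpos]

/-- The perspective of a convex function on `[0, ∞)` is convex on the open quadrant. -/
theorem ConvexOn.perspective_quadrant {g : ℝ → ℝ} (hg : ConvexOn ℝ (Set.Ici 0) g) :
    ConvexOn ℝ (Set.Ioi 0 ×ˢ Set.Ioi 0) fun q : ℝ × ℝ => q.2 * g (q.1 / q.2) := by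
  refine ⟨(convex_Ioi 0).prod (convex_Ioi 0), ?_⟩
  rintro ⟨p, s⟩ ⟨hp, hs⟩ ⟨q, t⟩ ⟨hq, ht⟩ a b ha hb hab
  simp only [Set.mem_Ioi] at hp hs hq ht
  have hst : 0 < a * s + b * t := by
    rcases ha.eq_or_lt with rfl | ha
    · have : b = 1 := by linarith
      simpa [this] using ht
    · positivity
  have hs' : 0 ≤ a * s / (a * s + b * t) := by positivity
  have ht' : 0 ≤ b * t / (a * s + b * t) := by positivity
  have key := hg.2 (div_pos hp hs).le (div_pos hq ht).le hs' ht' (by field_simp)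
  simp only [Prod.smul_mk, Prod.mk_add_mk, smul_eq_mul] at key ⊢
  have harg : a * s / (a * s + b * t) * (p / s) + b * t / (a * s + b * t) * (q / t) =
      (a * p + b * q) / (a * s + b * t) := by
    field_simp
  rw [harg] at key
  calc _ ≤ _ := mul_le_mul_of_nonneg_left key hst.le
    _ = _ := by field_simp

/-- For `θ, N₀, B, A > 0`, the time-sharing-relaxed per-subcarrier effective capacity
`f(p, φ) = −(φ/θ)·ln((N₀Bφ/p)·e^{N₀Bφ/p}·E_A(N₀Bφ/p))` is concave on the convex set
`{(p, φ) : p > 0, 0 < φ ≤ 1}`. -/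
theorem stmt_9 (θ N₀ B A : ℝ) (hθ : 0 < θ) (hN₀ : 0 < N₀) (hB : 0 < B) (hA : 0 < A) :
    ConcaveOn ℝ {q : ℝ × ℝ | 0 < q.1 ∧ 0 < q.2 ∧ q.2 ≤ 1}
      (fun q => -(q.2 / θ) * Real.log ((N₀ * B * q.2 / q.1) *
        Real.exp (N₀ * B * q.2 / q.1) * expInt A (N₀ * B * q.2 / q.1))) := by
  have hset : Convex ℝ {q : ℝ × ℝ | 0 < q.1 ∧ 0 < q.2 ∧ q.2 ≤ 1} := by
    exact (convex_Ioi (0 : ℝ)).prod (convex_Ioc (0 : ℝ) 1)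
  have hNB : 0 < N₀ * B := mul_pos hN₀ hB
  -- Rescaling the bandwidth variable absorbs the noise power.
  have hpersp := (convexOn_log_expMean hA.le).perspective_quadrant.comp_linearMap
    (LinearMap.prodMap LinearMap.id ((N₀ * B) • LinearMap.id))
  have hscaled := (hpersp.subset (fun q hq => ⟨hq.1, mul_pos hNB hq.2.1⟩) hset).smul
    (c := (θ * (N₀ * B))⁻¹) (by positivity)
  refine hscaled.neg.congr fun q hq => ?_
  obtain ⟨hp, hφ, -⟩ := hq
  rw [mul_exp_mul_expInt A (by positivity)]
  simp
  field_simp
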